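/- (Khintchine convergence for affine hyperplanes in positive characteristic) Let F = F_q((T^{-1})), Λ = F_q[T], a = (α_0,…,α_{n−1}) ∈ F^n, and let 𝓗 = {(x, x̃·a) : x ∈ F^{n−1}} be the affine hyperplane (x̃ = (1,x)). Let ψ : {q^r : r ≥ 0} → {q^r : r ∈ ℤ} be a nonincreasing approximation function. Assume there exists δ > 0 such that for all but finitely many q' ∈ Λ and all p = (p_0,…,p_{n−1}) ∈ Λ^n, max_{0≤i≤n−1} |p_i + α_i q'| > |q'|^{−(n−δ)}. If Σ_{t=0}^∞ ψ(q^t) q^{nt} < ∞, then the set of ψ-approximable points of 𝓗 has Haar measure zero. -/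

import Mathlib

open scoped Classical

/-- The element `T = X⁻¹` in `F_q((X)) = F_q((T⁻¹))`. -/
noncomputable def Tvar (Fq : Type) [Field Fq] : LaurentSeries Fq := (HahnSeries.single (-1 : ℤ) 1)

/-- The absolute value `|a| = q ^ (deg_T a) = q ^ (- order a)` on `F = F_q((T⁻¹))`. -/
noncomputable def absv (Fq : Type) [Field Fq] [Fintype Fq] (a : LaurentSeries Fq) : ℝ :=
  if a = 0 then 0 else (Fintype.card Fq : ℝ) ^ (-(a.order))

/-- The embedding of `Λ = F_q[T]` into `F = F_q((T⁻¹))`, sending `T ↦ X⁻¹`. -/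
noncomputable def ΛtoF (Fq : Type) [Field Fq] : Polynomial Fq →+* LaurentSeries Fq :=
  Polynomial.eval₂RingHom (algebraMap Fq (LaurentSeries Fq)) (Tvar Fq)

/-- The supremum norm on `F^n`. -/
noncomputable def supNorm (Fq : Type) [Field Fq] [Fintype Fq] {n : ℕ}
    (x : Fin n → LaurentSeries Fq) : ℝ :=
  ⨆ i, absv Fq (x i)

/-- `degVec q⃗` is the exponent `t` with `‖q⃗‖ = q^t` (for `q⃗ ≠ 0`). -/
def degVec {Fq : Type} [Field Fq] {n : ℕ} (v : Fin n → Polynomial Fq) : ℕ :=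
  Finset.univ.sup fun i => (v i).natDegree

open MeasureTheory

/-- The point `y = (x, x̃·a)` of the hyperplane `𝓗`, for `x ∈ F^{n-1}` (`n = m+1`). -/
noncomputable def hyperPt (Fq : Type) [Field Fq] {m : ℕ} (a : Fin (m + 1) → LaurentSeries Fq)
    (x : Fin m → LaurentSeries Fq) : Fin (m + 1) → LaurentSeries Fq :=
  Fin.snoc x (a 0 + ∑ j, a j.succ * x j)

/-- The closed ball `{f : |f| ≤ q ^ (-k)}` of `F`, as an additive subgroup. -/
def coeffBall (Fq : Type) [Field Fq] (k : ℤ) : AddSubgroup (LaurentSeries Fq) where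
  carrier := {f | ∀ n < k, f.coeff n = 0}
  add_mem' := by
    intro f g hf hg n hn
    simp [hf n hn, hg n hn]
  zero_mem' := by simp
  neg_mem' := by
    intro f hf n hn
    simp [hf n hn]

section Ball

variable {Fq : Type} [Field Fq]

theorem mem_coeffBall {k : ℤ} {f : LaurentSeries Fq} :
    f ∈ coeffBall Fq k ↔ ∀ n < k, f.coeff n = 0 := Iff.rfl

theorem mem_coeffBall_iff_valuation {k : ℤ} {f : LaurentSeries Fq} :
    f ∈ coeffBall Fq k ↔ Valued.v f ≤ WithZero.exp (-k) :=
  (LaurentSeries.valuation_le_iff_coeff_lt_eq_zero Fq).symm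

theorem coeffBall_anti {k l : ℤ} (h : k ≤ l) : coeffBall Fq l ≤ coeffBall Fq k :=
  fun _ hf n hn => hf n (hn.trans_le h)

theorem mul_mem_coeffBall {k l : ℤ} {f g : LaurentSeries Fq} (hf : f ∈ coeffBall Fq k)
    (hg : g ∈ coeffBall Fq l) : f * g ∈ coeffBall Fq (k + l) := by
  rw [mem_coeffBall_iff_valuation] at *
  rw [map_mul, neg_add, WithZero.exp_add]
  exact mul_le_mul' hf hg

theorem isOpen_coeffBall (k : ℤ) : IsOpen (coeffBall Fq k : Set (LaurentSeries Fq)) := by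
  apply AddSubgroup.isOpen_of_mem_nhds (coeffBall Fq k) (g := 0)
  rw [Valued.mem_nhds]
  have hne : Valued.v.restrict (HahnSeries.single k (1 : Fq) : LaurentSeries Fq) ≠ 0 := by
    simp
  refine ⟨Units.mk0 _ hne, fun y hy => ?_⟩
  have hy' : Valued.v y < Valued.v (HahnSeries.single k (1 : Fq) : LaurentSeries Fq) := by
    simpa using hy
  have hX : Valued.v (HahnSeries.single k (1 : Fq) : LaurentSeries Fq) ≤ WithZero.exp (-k) := by
    rw [← mem_coeffBall_iff_valuation, mem_coeffBall]
    intro n hn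
    rw [HahnSeries.coeff_single_of_ne hn.ne]
  exact mem_coeffBall_iff_valuation.2 (hy'.le.trans hX)

theorem mem_coeffBall_of_le_order {k : ℤ} {f : LaurentSeries Fq} (h : k ≤ f.order) :
    f ∈ coeffBall Fq k :=
  fun _ hn => HahnSeries.coeff_eq_zero_of_lt_order (hn.trans_le h)

theorem mem_coeffBall_iff_le_order {k : ℤ} {f : LaurentSeries Fq} (hf : f ≠ 0) :
    f ∈ coeffBall Fq k ↔ k ≤ f.order := by
  refine ⟨fun h => ?_, mem_coeffBall_of_le_order⟩
  by_contra! hlt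
  exact HahnSeries.coeff_order_eq_zero.not.2 hf (h _ hlt)

theorem mul_inv_mem_coeffBall_zero {s : ℤ} {y c : LaurentSeries Fq} (hy : y ∈ coeffBall Fq s)
    (hc : c ∉ coeffBall Fq (s + 1)) : y * c⁻¹ ∈ coeffBall Fq 0 := by
  rw [mem_coeffBall_iff_valuation] at *
  have hc0 : c ≠ 0 := by rintro rfl; simp at hc
  have hv : Valued.v c ≠ 0 := by simpa using hc0
  have : WithZero.exp (-s) ≤ Valued.v c := by
    rw [not_le] at hc
    obtain ⟨m, hm⟩ : ∃ m : ℤ, Valued.v c = WithZero.exp m := ⟨_, (WithZero.exp_log hv).symm⟩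
    rw [hm, WithZero.exp_lt_exp] at hc
    rw [hm, WithZero.exp_le_exp]
    lia
  rw [map_mul, map_inv₀, neg_zero, WithZero.exp_zero]
  exact mul_inv_le_one_of_le₀ (hy.trans this) zero_le

theorem absv_le_zpow_iff [Fintype Fq] {k : ℤ} {f : LaurentSeries Fq} :
    absv Fq f ≤ (Fintype.card Fq : ℝ) ^ (-k) ↔ f ∈ coeffBall Fq k := by
  have hq : 1 < (Fintype.card Fq : ℝ) := mod_cast Fintype.one_lt_card
  unfold absv
  split_ifs with h
  · simp only [h, zero_mem, iff_true]
    positivity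
  · rw [zpow_le_zpow_iff_right₀ hq, mem_coeffBall_iff_le_order h, neg_le_neg_iff]

theorem absv_lt_zpow_iff [Fintype Fq] {k : ℤ} {f : LaurentSeries Fq} :
    absv Fq f < (Fintype.card Fq : ℝ) ^ k ↔ f ∈ coeffBall Fq (1 - k) := by
  have hq : 1 < (Fintype.card Fq : ℝ) := mod_cast Fintype.one_lt_card
  unfold absv
  split_ifs with h
  · simp only [h, zero_mem, iff_true]
    positivity
  · rw [zpow_lt_zpow_iff_right₀ hq, mem_coeffBall_iff_le_order h]
    lia

theorem ΛtoF_monomial (i : ℕ) (c : Fq) :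
    ΛtoF Fq (Polynomial.monomial i c) = HahnSeries.single (-(i : ℤ)) c := by
  have h : (algebraMap Fq (LaurentSeries Fq)) c = HahnSeries.single 0 c := by
    rw [LaurentSeries.algebraMap_apply]; rfl
  simp [ΛtoF, Polynomial.eval₂_monomial, Tvar, HahnSeries.single_pow, h,
    HahnSeries.single_mul_single]

theorem ΛtoF_coeff (p : Polynomial Fq) (i : ℕ) : (ΛtoF Fq p).coeff (-(i : ℤ)) = p.coeff i := by
  induction p using Polynomial.induction_on' with
  | add p r hp hr => simp [hp, hr]
  | monomial j c =>
    rw [ΛtoF_monomial, HahnSeries.coeff_single, Polynomial.coeff_monomial]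
    simp [eq_comm]

theorem eq_zero_of_ΛtoF_mem_coeffBall {p : Polynomial Fq} {k : ℤ} (hk : 1 ≤ k)
    (h : ΛtoF Fq p ∈ coeffBall Fq k) : p = 0 := by
  ext i
  rw [← ΛtoF_coeff, h _ (by lia), Polynomial.coeff_zero]

theorem absv_ΛtoF [Fintype Fq] {p : Polynomial Fq} (hp : p ≠ 0) :
    absv Fq (ΛtoF Fq p) = (Fintype.card Fq : ℝ) ^ p.natDegree := by
  have hlead : (ΛtoF Fq p).coeff (-(p.natDegree : ℤ)) ≠ 0 := by
    rw [ΛtoF_coeff]; simpa using hp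
  have h0 : ΛtoF Fq p ≠ 0 := fun h => hlead (by simp [h])
  have hord : (ΛtoF Fq p).order = -(p.natDegree : ℤ) := by
    refine le_antisymm (HahnSeries.order_le_of_coeff_ne_zero hlead) ?_
    rw [← mem_coeffBall_iff_le_order h0]
    intro n hn
    lift -n to ℕ using (by lia) with i hi
    rw [show n = -(i : ℤ) by lia, ΛtoF_coeff]
    exact Polynomial.coeff_eq_zero_of_natDegree_lt (by lia)
  rw [absv, if_neg h0, hord, neg_neg, zpow_natCast]

theorem exists_sub_ΛtoF_mem (f : LaurentSeries Fq) :
    ∃ p : Polynomial Fq, f - ΛtoF Fq p ∈ coeffBall Fq 0 := by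
  refine ⟨∑ i ∈ Finset.range ((-f.order).toNat + 1), Polynomial.monomial i (f.coeff (-(i : ℤ))),
    fun n hn => ?_⟩
  lift -n to ℕ using (by lia) with i hi
  rw [show n = -(i : ℤ) by lia, HahnSeries.coeff_sub, ΛtoF_coeff]
  simp only [Polynomial.finsetSum_coeff, Polynomial.coeff_monomial, Finset.sum_ite_eq',
    Finset.mem_range]
  split_ifs with h
  · simp
  · rw [sub_zero]
    exact HahnSeries.coeff_eq_zero_of_lt_order (by lia)

end Ball

/-- The translate `z + {x : ‖x‖ ≤ 1}` of the unit ball of `F ^ m`. -/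
def unitBox {Fq : Type} [Field Fq] {m : ℕ} (z : Fin m → LaurentSeries Fq) :
    Set (Fin m → LaurentSeries Fq) :=
  {x | ∀ i, x i - z i ∈ coeffBall Fq 0}

/-- The points `x` of `unitBox z` at which the affine form `c · x + b` is within `q ^ (-K)`
of `Λ`. -/
def nearSet {Fq : Type} [Field Fq] {m : ℕ} (z c : Fin m → LaurentSeries Fq)
    (b : LaurentSeries Fq) (K : ℤ) : Set (Fin m → LaurentSeries Fq) :=
  {x | x ∈ unitBox z ∧ ∃ p : Polynomial Fq, ∑ i, c i * x i + b + ΛtoF Fq p ∈ coeffBall Fq K}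

section Measure

variable {Fq : Type} [Field Fq] {m : ℕ}

theorem isOpen_unitBox (z : Fin m → LaurentSeries Fq) : IsOpen (unitBox z) := by
  have : unitBox z = ⋂ i, (fun x : Fin m → LaurentSeries Fq => x i - z i) ⁻¹'
      (coeffBall Fq 0 : Set (LaurentSeries Fq)) := by
    ext x; simp [unitBox]
  rw [this]
  exact isOpen_iInter_of_finite fun i => (isOpen_coeffBall 0).preimage (by fun_prop)

theorem isOpen_nearSet (z c : Fin m → LaurentSeries Fq) (b : LaurentSeries Fq) (K : ℤ) :
    IsOpen (nearSet z c b K) := by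
  have : nearSet z c b K = unitBox z ∩ ⋃ p : Polynomial Fq,
      (fun x : Fin m → LaurentSeries Fq => ∑ i, c i * x i + b + ΛtoF Fq p) ⁻¹'
        (coeffBall Fq K : Set (LaurentSeries Fq)) := by
    ext x; simp [nearSet]
  rw [this]
  exact (isOpen_unitBox z).inter
    (isOpen_iUnion fun p => (isOpen_coeffBall K).preimage (by fun_prop))

theorem nearSet_anti (z c : Fin m → LaurentSeries Fq) (b : LaurentSeries Fq) {K L : ℤ}
    (h : K ≤ L) : nearSet z c b L ⊆ nearSet z c b K :=
  fun _ ⟨hx, p, hp⟩ => ⟨hx, p, coeffBall_anti h hp⟩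

/-- If the translates of a measurable set by a finite family are disjoint and stay in `D`, the set
has measure at most `μ D` over the size of the family. -/
theorem card_mul_measure_le {G ι : Type*} [AddGroup G] [MeasurableSpace G] [MeasurableAdd G]
    [Fintype ι] (μ : Measure G) [μ.IsAddLeftInvariant] {E D : Set G} (hE : MeasurableSet E)
    (g : ι → G) (hD : ∀ i, ∀ x ∈ E, g i + x ∈ D)
    (hg : ∀ i j, ∀ x ∈ E, ∀ y ∈ E, g i + x = g j + y → i = j) :
    (Fintype.card ι : ENNReal) * μ E ≤ μ D := by
  let T : ι → Set G := fun i => (fun x => -g i + x) ⁻¹' E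
  have hT : ∀ i, μ (T i) = μ E := fun i => measure_preimage_add μ _ _
  have hdisj : Pairwise (Function.onFun Disjoint T) := by
    intro i j hij
    refine Set.disjoint_left.2 fun x hi hj => hij (hg i j _ hi _ hj ?_)
    simp
  have hmeas : ∀ i, MeasurableSet (T i) := fun i => measurable_const_add _ hE
  calc (Fintype.card ι : ENNReal) * μ E = ∑ i, μ (T i) := by simp [hT]
    _ = μ (⋃ i, T i) := by rw [measure_iUnion hdisj hmeas, tsum_fintype]
    _ ≤ μ D := measure_mono <| Set.iUnion_subset fun i x hx => by
      simpa using hD i _ hx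

/-- The Laurent polynomial with coefficients `f` in degrees `s, …, s + N - 1`. -/
noncomputable def coeffBlock (s : ℤ) {N : ℕ} (f : Fin N → Fq) : LaurentSeries Fq :=
  ∑ i : Fin N, HahnSeries.single (s + ((i : ℕ) : ℤ)) (f i)

theorem coeffBlock_mem (s : ℤ) {N : ℕ} (f : Fin N → Fq) : coeffBlock s f ∈ coeffBall Fq s := by
  refine sum_mem fun i _ n hn => ?_
  rw [HahnSeries.coeff_single_of_ne]
  lia

theorem coeffBlock_coeff (s : ℤ) {N : ℕ} (f : Fin N → Fq) (i : Fin N) :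
    (coeffBlock s f).coeff (s + ((i : ℕ) : ℤ)) = f i := by
  simp [coeffBlock, HahnSeries.coeff_sum, HahnSeries.coeff_single, Fin.val_inj]

variable [Fintype Fq] [MeasurableSpace (Fin m → LaurentSeries Fq)]
  [BorelSpace (Fin m → LaurentSeries Fq)] (μ : Measure (Fin m → LaurentSeries Fq))
  [μ.IsAddHaarMeasure]

theorem measure_unitBox (hμ : μ {x : Fin m → LaurentSeries Fq | ∀ i, absv Fq (x i) ≤ 1} = 1)
    (z : Fin m → LaurentSeries Fq) : μ (unitBox z) = 1 := by
  have h : unitBox z = (fun x => -z + x) ⁻¹'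
      {x : Fin m → LaurentSeries Fq | ∀ i, absv Fq (x i) ≤ 1} := by
    ext x
    have (f : LaurentSeries Fq) : absv Fq f ≤ 1 ↔ f ∈ coeffBall Fq 0 := by
      simpa using absv_le_zpow_iff (k := 0) (f := f)
    simp [unitBox, this, neg_add_eq_sub]
  rw [h, measure_preimage_add, hμ]

theorem measure_nearSet_le
    (hμ : μ {x : Fin m → LaurentSeries Fq | ∀ i, absv Fq (x i) ≤ 1} = 1)
    (z c : Fin m → LaurentSeries Fq) (b : LaurentSeries Fq) (K : ℤ) {s : ℤ} (hs : 1 ≤ s)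
    {j : Fin m} (hj : c j ∉ coeffBall Fq (s + 1)) :
    μ (nearSet z c b K) ≤ ENNReal.ofReal ((Fintype.card Fq : ℝ) ^ (s - K)) := by
  have hq : 1 < (Fintype.card Fq : ℝ) := mod_cast Fintype.one_lt_card
  have hc0 : c j ≠ 0 := fun h => hj (h ▸ zero_mem _)
  set N := (K - s).toNat with hN
  let g : (Fin N → Fq) → Fin m → LaurentSeries Fq := fun f =>
    Pi.single j (coeffBlock s f * (c j)⁻¹)
  have key : ((Fintype.card (Fin N → Fq) : ℕ) : ENNReal) * μ (nearSet z c b K) ≤ 1 := by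
    rw [← measure_unitBox μ hμ z]
    refine card_mul_measure_le μ (isOpen_nearSet z c b K).measurableSet g ?_ ?_
    · rintro f x ⟨hx, -⟩ i
      rw [Pi.add_apply, add_sub_assoc]
      refine add_mem ?_ (hx i)
      obtain rfl | hij := eq_or_ne i j
      · simpa [g] using mul_inv_mem_coeffBall_zero (coeffBlock_mem s f) hj
      · simp [g, hij]
    · rintro f f' x ⟨-, p, hp⟩ y ⟨-, p', hp'⟩ hxy
      have hsum (f : Fin N → Fq) (x : Fin m → LaurentSeries Fq) :
          ∑ i, c i * (g f + x) i = coeffBlock s f + ∑ i, c i * x i := by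
        simp only [Pi.add_apply, mul_add, Finset.sum_add_distrib]
        congr 1
        rw [Finset.sum_eq_single j]
        · simp only [g, Pi.single_eq_same]
          field_simp
        · intro i _ hij
          simp [g, hij]
        · simp
      have h1 : coeffBlock s f + ∑ i, c i * x i = coeffBlock s f' + ∑ i, c i * y i := by
        rw [← hsum, ← hsum, hxy]
      have h2 : coeffBlock s f - coeffBlock s f' - ΛtoF Fq (p - p') ∈ coeffBall Fq K := by
        convert sub_mem hp' hp using 1
        rw [map_sub]
        linear_combination h1
      funext i
      have hK : s + ((i : ℕ) : ℤ) < K := by have := i.isLt; lia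
      have h3 : ΛtoF Fq (p - p') ∈ coeffBall Fq s := by
        have := sub_mem (sub_mem (coeffBlock_mem s f) (coeffBlock_mem s f'))
          (coeffBall_anti (k := s) (by lia) h2)
        simpa using this
      rw [eq_zero_of_ΛtoF_mem_coeffBall hs h3, map_zero, sub_zero] at h2
      have := h2 _ hK
      rwa [HahnSeries.coeff_sub, coeffBlock_coeff, coeffBlock_coeff, sub_eq_zero] at this
  rw [Fintype.card_fun, Fintype.card_fin] at key
  have hle : (1 : ENNReal) ≤
      ((Fintype.card Fq ^ N : ℕ) : ENNReal) *
        ENNReal.ofReal ((Fintype.card Fq : ℝ) ^ (s - K)) := by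
    rw [← ENNReal.ofReal_natCast, ← ENNReal.ofReal_mul (by positivity), ENNReal.one_le_ofReal]
    push_cast
    rw [← zpow_natCast, ← zpow_add₀ (by positivity)]
    exact one_le_zpow₀ hq.le (by lia)
  have hpos : ((Fintype.card Fq ^ N : ℕ) : ENNReal) ≠ 0 := by
    simp
  exact (ENNReal.mul_le_mul_iff_right hpos (ENNReal.natCast_ne_top _)).1 (key.trans hle)

end Measure

section Counting

variable {Fq : Type} [Field Fq] {m : ℕ}

/-- The linear coefficients of `x ↦ y · v`, where `y` is the point of the hyperplane above `x`. -/
noncomputable def linCoeff (a : Fin (m + 1) → LaurentSeries Fq) (v : Fin (m + 1) → Polynomial Fq) :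
    Fin m → LaurentSeries Fq :=
  fun j => ΛtoF Fq (v j.castSucc) + a j.succ * ΛtoF Fq (v (Fin.last m))

theorem sum_hyperPt_mul (a : Fin (m + 1) → LaurentSeries Fq) (v : Fin (m + 1) → Polynomial Fq)
    (x : Fin m → LaurentSeries Fq) :
    ∑ i, hyperPt Fq a x i * ΛtoF Fq (v i) =
      ∑ j, linCoeff a v j * x j + a 0 * ΛtoF Fq (v (Fin.last m)) := by
  simp only [hyperPt, linCoeff, Fin.sum_univ_castSucc, Fin.snoc_castSucc, Fin.snoc_last, add_mul,
    Finset.sum_add_distrib, Finset.sum_mul]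
  have h1 : ∑ j, x j * ΛtoF Fq (v j.castSucc) = ∑ j, ΛtoF Fq (v j.castSucc) * x j :=
    Finset.sum_congr rfl fun j _ => mul_comm _ _
  have h2 : ∑ j, a j.succ * x j * ΛtoF Fq (v (Fin.last m)) =
      ∑ j, a j.succ * ΛtoF Fq (v (Fin.last m)) * x j :=
    Finset.sum_congr rfl fun j _ => mul_right_comm _ _ _
  rw [h1, h2]
  ring

/-- Beyond degree `D`, the vector `a` is not approximated by rationals of denominator `w` with
exponent `m + 1`. -/
def NotApproxBeyond (a : Fin (m + 1) → LaurentSeries Fq) (D : ℕ) : Prop :=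
  ∀ w : Polynomial Fq, D < w.natDegree → ∀ p : Fin (m + 1) → Polynomial Fq,
    ∃ i, ΛtoF Fq (p i) + a i * ΛtoF Fq w ∉ coeffBall Fq ((m + 1) * w.natDegree)

theorem exists_notApproxBeyond [Fintype Fq] (a : Fin (m + 1) → LaurentSeries Fq)
    (hdio : ∃ δ > (0 : ℝ),
      {q' : Polynomial Fq | ∃ p : Fin (m + 1) → Polynomial Fq,
        (⨆ i, absv Fq (ΛtoF Fq (p i) + a i * ΛtoF Fq q')) ≤
          1 / (absv Fq (ΛtoF Fq q')) ^ (((m : ℝ) + 1) - δ)}.Finite) :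
    ∃ D, NotApproxBeyond a D := by
  have hq : 1 < (Fintype.card Fq : ℝ) := mod_cast Fintype.one_lt_card
  obtain ⟨δ, hδ, hfin⟩ := hdio
  obtain ⟨D, hD⟩ := (hfin.image Polynomial.natDegree).bddAbove
  refine ⟨D, fun w hw p => ?_⟩
  by_contra! h
  refine hw.not_ge (hD ⟨w, ⟨p, ciSup_le fun i => ?_⟩, rfl⟩)
  have hw0 : w ≠ 0 := by rintro rfl; simp at hw
  refine (absv_le_zpow_iff.2 (h i)).trans ?_
  rw [absv_ΛtoF hw0, one_div, ← Real.rpow_natCast, ← Real.rpow_mul (by positivity),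
    ← Real.rpow_neg (by positivity), ← Real.rpow_intCast]
  refine Real.rpow_le_rpow_of_exponent_le hq.le ?_
  push_cast
  have : 0 ≤ (w.natDegree : ℝ) := by positivity
  nlinarith

/-- The vectors `v` with last coordinate of degree at most `d` for which all `linCoeff a v j` have
absolute value less than `1` and, when `e ≠ 0`, these and the constant term modulo `Λ` have
absolute value at most `q ^ (-(m + 1) e)`. -/
def smallVecs (a : Fin (m + 1) → LaurentSeries Fq) (e d : ℕ) :
    Set (Fin (m + 1) → Polynomial Fq) :=
  {v | (∀ j, linCoeff a v j ∈ coeffBall Fq 1) ∧ (v (Fin.last m)).natDegree ≤ d ∧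
    (e = 0 ∨ (∃ p, ΛtoF Fq p + a 0 * ΛtoF Fq (v (Fin.last m)) ∈ coeffBall Fq ((m + 1) * e)) ∧
      ∀ j, linCoeff a v j ∈ coeffBall Fq ((m + 1) * e))}

theorem linCoeff_sub (a : Fin (m + 1) → LaurentSeries Fq) (v w : Fin (m + 1) → Polynomial Fq)
    (j : Fin m) : linCoeff a v j - linCoeff a w j = linCoeff a (v - w) j := by
  simp only [linCoeff, Pi.sub_apply, map_sub]
  ring

theorem smallVecs_injOn {a : Fin (m + 1) → LaurentSeries Fq} {D : ℕ} (ha : NotApproxBeyond a D)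
    (e d : ℕ) :
    Set.InjOn (fun (v : Fin (m + 1) → Polynomial Fq)
      (i : ↥(Finset.range (D + 1) ∪ Finset.Ioc e d)) => (v (Fin.last m)).coeff i)
      (smallVecs a e d) := by
  rintro v ⟨hv1, hvd, hv⟩ w ⟨hw1, hwd, hw⟩ hvw
  have hcoeff (i : ℕ) (hi : i ∈ Finset.range (D + 1) ∪ Finset.Ioc e d) :
      ((v - w) (Fin.last m)).coeff i = 0 := by
    have := congrFun hvw ⟨i, hi⟩
    simpa [sub_eq_zero] using this
  have hlast : (v - w) (Fin.last m) = 0 := by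
    by_contra hne
    have hlead : ((v - w) (Fin.last m)).coeff ((v - w) (Fin.last m)).natDegree ≠ 0 := by
      simpa using hne
    have hdeg : ((v - w) (Fin.last m)).natDegree ≤ d :=
      (Polynomial.natDegree_sub_le _ _).trans (max_le hvd hwd)
    have hnot := mt (hcoeff _) hlead
    simp only [Finset.mem_union, Finset.mem_range, Finset.mem_Ioc, not_or, not_and] at hnot
    have hD : D < ((v - w) (Fin.last m)).natDegree := by lia
    have he : ((v - w) (Fin.last m)).natDegree ≤ e := by
      by_contra! hlt
      exact hnot.2 hlt hdeg
    have he0 : e ≠ 0 := by lia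
    obtain ⟨⟨p, hp⟩, hv2⟩ := hv.resolve_left he0
    obtain ⟨⟨p', hp'⟩, hw2⟩ := hw.resolve_left he0
    have hle : ((m : ℤ) + 1) * ((v - w) (Fin.last m)).natDegree ≤ (m + 1) * e := by gcongr
    obtain ⟨i, hi⟩ := ha _ hD (Fin.cons (p - p') fun j => (v - w) j.castSucc)
    refine hi (coeffBall_anti hle ?_)
    refine Fin.cases ?_ (fun j => ?_) i
    · convert sub_mem hp hp' using 1
      simp only [Fin.cons_zero, Pi.sub_apply, map_sub]
      ring
    · have := sub_mem (hv2 j) (hw2 j)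
      rwa [linCoeff_sub] at this
  rw [← sub_eq_zero]
  funext i
  refine Fin.lastCases hlast (fun j => ?_) i
  have h1 := linCoeff_sub a v w j ▸ sub_mem (hv1 j) (hw1 j)
  rw [linCoeff, hlast, map_zero, mul_zero, add_zero] at h1
  exact eq_zero_of_ΛtoF_mem_coeffBall le_rfl h1

theorem smallVecs_finite [Finite Fq] {a : Fin (m + 1) → LaurentSeries Fq} {D : ℕ}
    (ha : NotApproxBeyond a D) (e d : ℕ) : (smallVecs a e d).Finite :=
  Set.Finite.of_injOn (Set.mapsTo_univ _ _) (smallVecs_injOn ha e d) Set.finite_univ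

theorem ncard_smallVecs_le [Fintype Fq] {a : Fin (m + 1) → LaurentSeries Fq} {D : ℕ}
    (ha : NotApproxBeyond a D) (e d : ℕ) :
    (smallVecs a e d).ncard ≤ Fintype.card Fq ^ (D + 1 + (d - e)) := by
  refine (Set.ncard_le_ncard_of_injOn _ (fun _ _ => Set.mem_univ _) (smallVecs_injOn ha e d)
    Set.finite_univ).trans ?_
  rw [Set.ncard_univ, Nat.card_eq_fintype_card, Fintype.card_fun, Fintype.card_coe]
  refine Nat.pow_le_pow_right Fintype.card_pos ((Finset.card_union_le _ _).trans ?_)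
  simp

theorem degVec_injOn (t : ℕ) :
    Set.InjOn (fun (v : Fin (m + 1) → Polynomial Fq) (i : Fin (m + 1) × Fin (t + 1)) =>
      (v i.1).coeff i.2) {v | degVec v = t} := by
  intro v hv w hw hvw
  have hle {u : Fin (m + 1) → Polynomial Fq} (hu : degVec u = t) (i : Fin (m + 1)) :
      (u i).natDegree ≤ t :=
    hu ▸ Finset.le_sup (f := fun i => (u i).natDegree) (Finset.mem_univ i)
  ext i k
  by_cases hk : k < t + 1
  · exact congrFun hvw (i, ⟨k, hk⟩)
  · rw [Polynomial.coeff_eq_zero_of_natDegree_lt ((hle hv i).trans_lt (by lia)),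
      Polynomial.coeff_eq_zero_of_natDegree_lt ((hle hw i).trans_lt (by lia))]

theorem degVec_finite [Finite Fq] (t : ℕ) :
    {v : Fin (m + 1) → Polynomial Fq | degVec v = t}.Finite :=
  Set.Finite.of_injOn (Set.mapsTo_univ _ _) (degVec_injOn t) Set.finite_univ

theorem ncard_degVec_le [Fintype Fq] (t : ℕ) :
    {v : Fin (m + 1) → Polynomial Fq | degVec v = t}.ncard ≤
      Fintype.card Fq ^ ((m + 1) * (t + 1)) := by
  refine (Set.ncard_le_ncard_of_injOn _ (fun _ _ => Set.mem_univ _) (degVec_injOn t)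
    Set.finite_univ).trans ?_
  rw [Set.ncard_univ, Nat.card_eq_fintype_card, Fintype.card_fun]
  simp

theorem natDegree_le_degVec (v : Fin (m + 1) → Polynomial Fq) (i : Fin (m + 1)) :
    (v i).natDegree ≤ degVec v :=
  Finset.le_sup (f := fun i => (v i).natDegree) (Finset.mem_univ i)

theorem countable_polynomial [Finite Fq] : Countable (Polynomial Fq) := by
  refine Function.Injective.countable (β := ℕ →₀ Fq)
    (f := fun p => Finsupp.ofSupportFinite p.coeff
      (p.support.finite_toSet.subset fun i hi => Polynomial.mem_support_iff.2 hi)) ?_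
  intro p r h
  ext i
  exact DFunLike.congr_fun h i

end Counting

section BorelCantelli

/-- Borel–Cantelli with a summable real bound that holds from some index on. -/
theorem ae_finite_of_measure_le {α : Type*} [MeasurableSpace α] {μ : Measure α} {A : ℕ → Set α}
    {f : ℕ → ℝ} (hf : Summable f) (D : ℕ)
    (hA : ∀ d > D, μ (A d) ≤ ENNReal.ofReal (f d)) : ∀ᵐ x ∂μ, {d | x ∈ A d}.Finite := by
  have hsum : ∑' d, μ (A (d + (D + 1))) ≠ ⊤ := by
    refine ne_top_of_le_ne_top ((summable_nat_add_iff (D + 1)).2 hf).tsum_ofReal_ne_top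
      (ENNReal.tsum_le_tsum fun d => hA _ (by lia))
  filter_upwards [ae_finite_setOfPred_mem hsum] with x hx
  refine ((hx.image (· + (D + 1))).union (Set.finite_le_nat D)).subset fun d hd => ?_
  by_cases h : d ≤ D
  · exact Or.inr h
  · obtain ⟨k, rfl⟩ : ∃ k, d = k + (D + 1) := ⟨d - (D + 1), by lia⟩
    exact Or.inl ⟨k, hd, rfl⟩

theorem measure_biUnion_le_ncard_mul {α ι : Type*} [MeasurableSpace α] (μ : Measure α)
    {S : Set ι} (hS : S.Finite) (T : ι → Set α) {β : ENNReal} (hT : ∀ i ∈ S, μ (T i) ≤ β) :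
    μ (⋃ i ∈ S, T i) ≤ S.ncard * β := by
  have h := measure_biUnion_finset_le (μ := μ) hS.toFinset T
  simp only [Set.Finite.mem_toFinset] at h
  refine h.trans ((Finset.sum_le_card_nsmul _ _ β fun i hi => hT i (by simpa using hi)).trans ?_)
  rw [nsmul_eq_mul, Set.ncard_eq_toFinset_card S hS]

theorem geom_sum_le_pow {Q : ℝ} (hQ : 2 ≤ Q) (d : ℕ) : ∑ e ∈ Finset.range d, Q ^ e ≤ Q ^ d := by
  induction d with
  | zero => simp
  | succ d ih =>
    rw [Finset.sum_range_succ, pow_succ]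
    nlinarith [pow_pos (show 0 < Q by linarith) d]

variable {Fq : Type} [Field Fq] {m : ℕ}

/-- The points of `unitBox z` approximated to order `K t` by some `v` with `‖v‖ = q ^ t` for which
the linear coefficients are not all less than `1`. -/
def largeSet (z : Fin m → LaurentSeries Fq) (a : Fin (m + 1) → LaurentSeries Fq) (K : ℕ → ℤ)
    (t : ℕ) : Set (Fin m → LaurentSeries Fq) :=
  {x | ∃ v, degVec v = t ∧ (∃ j, linCoeff a v j ∉ coeffBall Fq 1) ∧
    x ∈ nearSet z (linCoeff a v) (a 0 * ΛtoF Fq (v (Fin.last m))) (K t)}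

/-- The points of `unitBox z` approximated to order `K d` by some `v` with last coordinate of
degree `d` for which the linear coefficients are all less than `1`. -/
def smallSet (z : Fin m → LaurentSeries Fq) (a : Fin (m + 1) → LaurentSeries Fq) (K : ℕ → ℤ)
    (d : ℕ) : Set (Fin m → LaurentSeries Fq) :=
  {x | ∃ v, (v (Fin.last m)).natDegree = d ∧ (∀ j, linCoeff a v j ∈ coeffBall Fq 1) ∧
    x ∈ nearSet z (linCoeff a v) (a 0 * ΛtoF Fq (v (Fin.last m))) (K d)}

/-- A vector counted in `smallSet` lies in some `smallVecs a e d`, `e < d`, while one of its linear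
coefficients has absolute value greater than `q ^ (-((m + 1) (e + 1) + R))`. -/
theorem exists_mem_smallVecs {a : Fin (m + 1) → LaurentSeries Fq} {D : ℕ}
    (ha : NotApproxBeyond a D) {z : Fin m → LaurentSeries Fq} {R : ℕ}
    (hR : ∀ i, z i ∈ coeffBall Fq (-R)) {d : ℕ} (hd : D < d) {K : ℤ} (hK : (m + 1) * (d : ℤ) ≤ K)
    {v : Fin (m + 1) → Polynomial Fq} (hvd : (v (Fin.last m)).natDegree = d)
    (hv : ∀ j, linCoeff a v j ∈ coeffBall Fq 1) {x : Fin m → LaurentSeries Fq}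
    (hx : x ∈ nearSet z (linCoeff a v) (a 0 * ΛtoF Fq (v (Fin.last m))) K) :
    ∃ e < d, v ∈ smallVecs a e d ∧
      ∃ j, linCoeff a v j ∉ coeffBall Fq ((m + 1) * ((e : ℤ) + 1) + R) := by
  have hdnot : v ∉ smallVecs a (d - 1 + 1) d := by
    rintro ⟨_, _, h⟩
    rw [Nat.sub_add_cancel (by lia)] at h
    obtain ⟨⟨p, hp⟩, hc⟩ := h.resolve_left (by lia)
    obtain ⟨i, hi⟩ := ha _ (hvd ▸ hd) (Fin.cons p fun j => v j.castSucc)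
    rw [hvd] at hi
    exact hi (Fin.cases (by simpa using hp) (fun j => by simpa [linCoeff] using hc j) i)
  have hend : ∃ e, v ∉ smallVecs a (e + 1) d := ⟨d - 1, hdnot⟩
  set e := Nat.find hend
  have hnot : v ∉ smallVecs a (e + 1) d := Nat.find_spec hend
  have hmem : v ∈ smallVecs a e d := by
    rcases Nat.eq_zero_or_pos e with h0 | h0
    · exact ⟨hv, hvd.le, Or.inl h0⟩
    · have := Nat.find_min hend (m := e - 1) (by lia)
      rwa [not_not, Nat.sub_add_cancel h0] at this
  have hed : e < d := by
    by_contra! hlt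
    exact Nat.find_min hend (m := d - 1) (by lia) hdnot
  refine ⟨e, hed, hmem, ?_⟩
  by_contra! hall
  obtain ⟨hxz, p, hp⟩ := hx
  have hxR (i) : x i ∈ coeffBall Fq (-R) := by
    have := add_mem (coeffBall_anti (k := -(R : ℤ)) (by lia) (hxz i)) (hR i)
    rwa [sub_add_cancel] at this
  have hsum : ∑ i, linCoeff a v i * x i ∈ coeffBall Fq ((m + 1) * ((e : ℤ) + 1)) :=
    sum_mem fun i _ => by simpa using mul_mem_coeffBall (hall i) (hxR i)
  have hle : ((m : ℤ) + 1) * (e + 1) ≤ (m + 1) * d := by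
    have : (e : ℤ) + 1 ≤ d := by lia
    gcongr
  refine hnot ⟨hv, hvd.le, Or.inr ⟨⟨p, ?_⟩, fun j => ?_⟩⟩
  · have := sub_mem (coeffBall_anti (hle.trans hK) hp) hsum
    push_cast
    convert this using 1
    ring
  · push_cast
    exact coeffBall_anti (by lia) (hall j)

variable [Fintype Fq] [MeasurableSpace (Fin m → LaurentSeries Fq)]
  [BorelSpace (Fin m → LaurentSeries Fq)] (μ : Measure (Fin m → LaurentSeries Fq))
  [μ.IsAddHaarMeasure]

theorem measure_largeSet_le
    (hμ : μ {x : Fin m → LaurentSeries Fq | ∀ i, absv Fq (x i) ≤ 1} = 1)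
    (z : Fin m → LaurentSeries Fq) (a : Fin (m + 1) → LaurentSeries Fq) (K : ℕ → ℤ) (t : ℕ) :
    μ (largeSet z a K t) ≤ ENNReal.ofReal
      ((Fintype.card Fq : ℝ) ^ ((m + 1) * (t + 1)) * (Fintype.card Fq : ℝ) ^ (1 - K t)) := by
  let S : Set (Fin (m + 1) → Polynomial Fq) :=
    {v | degVec v = t ∧ ∃ j, linCoeff a v j ∉ coeffBall Fq 1}
  have hsub : S ⊆ {v | degVec v = t} := fun v hv => hv.1
  have hle := measure_biUnion_le_ncard_mul μ ((degVec_finite t).subset hsub)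
    (fun v => nearSet z (linCoeff a v) (a 0 * ΛtoF Fq (v (Fin.last m))) (K t))
    (fun v ⟨_, _, hj⟩ => measure_nearSet_le μ hμ z _ _ (K t) le_rfl
      (mt (fun h => coeffBall_anti (by lia) h) hj))
  refine (measure_mono ?_).trans (hle.trans ?_)
  · rintro x ⟨v, hv, hj, hx⟩
    exact Set.mem_biUnion (show v ∈ S from ⟨hv, hj⟩) hx
  · rw [ENNReal.ofReal_mul (by positivity)]
    gcongr
    rw [← ENNReal.ofReal_natCast]
    gcongr
    exact_mod_cast (Set.ncard_le_ncard hsub (degVec_finite t)).trans (ncard_degVec_le t)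

theorem measure_smallSet_le (hm : 1 ≤ m)
    (hμ : μ {x : Fin m → LaurentSeries Fq | ∀ i, absv Fq (x i) ≤ 1} = 1)
    {a : Fin (m + 1) → LaurentSeries Fq} {D : ℕ} (ha : NotApproxBeyond a D)
    {z : Fin m → LaurentSeries Fq} {R : ℕ} (hR : ∀ i, z i ∈ coeffBall Fq (-R))
    {K : ℕ → ℤ} {d : ℕ} (hd : D < d) (hK : (m + 1) * (d : ℤ) ≤ K d) :
    μ (smallSet z a K d) ≤ ENNReal.ofReal ((Fintype.card Fq : ℝ) ^ (D + 1 + m + R) *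
      ((Fintype.card Fq : ℝ) ^ ((m + 1) * d) * (Fintype.card Fq : ℝ) ^ (-K d))) := by
  have hq1 : 2 ≤ (Fintype.card Fq : ℝ) := mod_cast Fintype.one_lt_card
  set q : ℝ := (Fintype.card Fq : ℝ)
  have hq0 : q ≠ 0 := by positivity
  let β : ℕ → ℝ := fun e => q ^ ((m + 1) * ((e : ℤ) + 1) + R - 1 - K d)
  let S : ℕ → Set (Fin (m + 1) → Polynomial Fq) := fun e =>
    {v | v ∈ smallVecs a e d ∧ ∃ j, linCoeff a v j ∉ coeffBall Fq ((m + 1) * ((e : ℤ) + 1) + R)}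
  let T : (Fin (m + 1) → Polynomial Fq) → Set (Fin m → LaurentSeries Fq) := fun v =>
    nearSet z (linCoeff a v) (a 0 * ΛtoF Fq (v (Fin.last m))) (K d)
  have hsub (e : ℕ) : S e ⊆ smallVecs a e d := fun v hv => hv.1
  have hT (e : ℕ) : μ (⋃ v ∈ S e, T v) ≤ ENNReal.ofReal (q ^ (D + 1 + (d - e)) * β e) := by
    refine (measure_biUnion_le_ncard_mul μ ((smallVecs_finite ha e d).subset (hsub e)) T
      (β := ENNReal.ofReal (β e)) fun v ⟨_, j, hj⟩ => ?_).trans ?_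
    · refine measure_nearSet_le μ hμ z _ _ (K d) (j := j) ?_ (by rwa [sub_add_cancel])
      have : 0 ≤ (m : ℤ) * e := by positivity
      have : (m + 1) * ((e : ℤ) + 1) = m * e + m + e + 1 := by ring
      lia
    · rw [ENNReal.ofReal_mul (by positivity)]
      gcongr
      rw [← ENNReal.ofReal_natCast]
      gcongr
      simp only [q]
      exact_mod_cast (Set.ncard_le_ncard (hsub e) (smallVecs_finite ha e d)).trans
        (ncard_smallVecs_le ha e d)
  calc μ (smallSet z a K d) ≤ μ (⋃ e ∈ Finset.range d, ⋃ v ∈ S e, T v) := by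
        refine measure_mono fun x ⟨v, hvd, hv, hx⟩ => ?_
        obtain ⟨e, he, hve⟩ := exists_mem_smallVecs ha hR hd hK hvd hv hx
        exact Set.mem_biUnion (Finset.mem_coe.2 (Finset.mem_range.2 he)) (Set.mem_biUnion hve hx)
    _ ≤ ∑ e ∈ Finset.range d, ENNReal.ofReal (q ^ (D + 1 + (d - e)) * β e) :=
        (measure_biUnion_finset_le _ _).trans (Finset.sum_le_sum fun e _ => hT e)
    _ = ENNReal.ofReal (∑ e ∈ Finset.range d, q ^ (D + 1 + (d - e)) * β e) :=
        (ENNReal.ofReal_sum_of_nonneg fun e _ => by positivity).symm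
    _ ≤ _ := by
        refine ENNReal.ofReal_le_ofReal ?_
        have hterm : ∀ e ∈ Finset.range d, q ^ (D + 1 + (d - e)) * β e =
            q ^ (D + 1 + m + R) * (q ^ d * q ^ (-K d)) * (q ^ m) ^ e := by
          intro e he
          have he' := Finset.mem_range.1 he
          simp only [β, ← pow_mul]
          simp only [← zpow_natCast, ← zpow_add₀ hq0]
          congr 1
          push_cast [Nat.cast_sub he'.le]
          ring
        rw [Finset.sum_congr rfl hterm, ← Finset.mul_sum]
        have hQ : 2 ≤ q ^ m := hq1.trans (le_self_pow₀ (by linarith) (by lia))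
        calc _ ≤ q ^ (D + 1 + m + R) * (q ^ d * q ^ (-K d)) * (q ^ m) ^ d := by
              gcongr
              exact geom_sum_le_pow hQ d
          _ = _ := by ring

end BorelCantelli

/-- Khintchine convergence for affine hyperplanes in positive characteristic:
under the Diophantine condition on `a` and convergence of `Σ ψ(q^t) q^{nt}`, the set of
`ψ`-approximable points of the hyperplane `𝓗 = {(x, x̃·a)}` has Haar measure zero.
Here `n = m + 1` and `ψ t` denotes the value of the approximating function at `q^t`. -/
theorem khintchine_convergence_hyperplane (Fq : Type) [Field Fq] [Fintype Fq]
    (m : ℕ) (hm : 1 ≤ m)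
    [MeasurableSpace (Fin m → LaurentSeries Fq)]
    [BorelSpace (Fin m → LaurentSeries Fq)]
    (μ : Measure (Fin m → LaurentSeries Fq)) [μ.IsAddHaarMeasure]
    (hμ : μ {x : Fin m → LaurentSeries Fq | ∀ i, absv Fq (x i) ≤ 1} = 1)
    (a : Fin (m + 1) → LaurentSeries Fq)
    (ψ : ℕ → ℝ) (hψval : ∀ t, ∃ r : ℤ, ψ t = (Fintype.card Fq : ℝ) ^ r)
    (hψanti : Antitone ψ)
    -- the Diophantine condition (1.2): for some `δ > 0`, for all but finitely many `q' ∈ Λ`,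
    -- `max_i |p_i + α_i q'| > |q'|^{-(n-δ)}` for all `p ∈ Λ^n`
    (hdio : ∃ δ > (0 : ℝ),
      {q' : Polynomial Fq | ∃ p : Fin (m + 1) → Polynomial Fq,
        (⨆ i, absv Fq (ΛtoF Fq (p i) + a i * ΛtoF Fq q')) ≤
          1 / (absv Fq (ΛtoF Fq q')) ^ (((m : ℝ) + 1) - δ)}.Finite)
    (hconv : Summable fun t : ℕ => ψ t * (Fintype.card Fq : ℝ) ^ ((m + 1) * t)) :
    μ {x : Fin m → LaurentSeries Fq |
        {v : Fin (m + 1) → Polynomial Fq | v ≠ 0 ∧ ∃ p : Polynomial Fq,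
          absv Fq ((∑ i, hyperPt Fq a x i * ΛtoF Fq (v i)) + ΛtoF Fq p)
            < ψ (degVec v)}.Infinite} = 0 := by
  obtain ⟨D₀, hD₀⟩ := exists_notApproxBeyond a hdio
  choose r hr using hψval
  have hq : 1 < (Fintype.card Fq : ℝ) := mod_cast Fintype.one_lt_card
  set q : ℝ := (Fintype.card Fq : ℝ)
  have hq0 : q ≠ 0 := by positivity
  let K : ℕ → ℤ := fun t => 1 - r t
  have hKmono : Monotone K := fun s t hst => by
    have := hψanti hst
    rw [hr, hr, zpow_le_zpow_iff_right₀ hq] at this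
    exact sub_le_sub_left this 1
  obtain ⟨D₁, hD₁⟩ : ∃ D₁ : ℕ, ∀ t ≥ D₁, (m + 1) * (t : ℤ) ≤ K t := by
    refine Filter.eventually_atTop.1 ?_
    filter_upwards [hconv.tendsto_atTop_zero.eventually_lt_const (zero_lt_one' ℝ)] with t ht
    rw [hr, ← zpow_natCast, ← zpow_add₀ hq0, zpow_lt_one_iff_right₀ hq] at ht
    push_cast at ht
    simp only [K]
    lia
  have hsub : {x : Fin m → LaurentSeries Fq |
      {v : Fin (m + 1) → Polynomial Fq | v ≠ 0 ∧ ∃ p : Polynomial Fq,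
        absv Fq ((∑ i, hyperPt Fq a x i * ΛtoF Fq (v i)) + ΛtoF Fq p) < ψ (degVec v)}.Infinite} ⊆
      ⋃ z : Fin m → Polynomial Fq, {x | ¬
        ({t | x ∈ largeSet (fun i => ΛtoF Fq (z i)) a K t}.Finite ∧
        {d | x ∈ smallSet (fun i => ΛtoF Fq (z i)) a K d}.Finite)} := by
    intro x hx
    choose z hz using fun i => exists_sub_ΛtoF_mem (x i)
    refine Set.mem_iUnion.2 ⟨z, fun ⟨hlarge, hsmall⟩ => hx ?_⟩
    refine ((hlarge.biUnion fun t _ => degVec_finite t).union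
      (hsmall.biUnion fun d _ => smallVecs_finite hD₀ 0 d)).subset ?_
    rintro v ⟨-, p, hp⟩
    rw [hr, absv_lt_zpow_iff, sum_hyperPt_mul] at hp
    have hnear : x ∈ nearSet (fun i => ΛtoF Fq (z i)) (linCoeff a v)
        (a 0 * ΛtoF Fq (v (Fin.last m))) (K (degVec v)) := ⟨hz, p, hp⟩
    by_cases h : ∀ j, linCoeff a v j ∈ coeffBall Fq 1
    · have hle := hKmono (natDegree_le_degVec v (Fin.last m))
      exact Or.inr (Set.mem_biUnion (x := (v (Fin.last m)).natDegree)
        ⟨v, rfl, h, nearSet_anti _ _ _ hle hnear⟩ ⟨h, le_rfl, Or.inl rfl⟩)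
    · push Not at h
      exact Or.inl (Set.mem_biUnion (x := degVec v) ⟨v, rfl, h, hnear⟩ rfl)
  refine measure_mono_null hsub ?_
  have := countable_polynomial (Fq := Fq)
  refine measure_iUnion_null fun z => ?_
  obtain ⟨R, hR⟩ : ∃ R : ℕ, ∀ i, ΛtoF Fq (z i) ∈ coeffBall Fq (-R) := by
    refine ⟨∑ i, (-(ΛtoF Fq (z i)).order).toNat, fun i => mem_coeffBall_of_le_order ?_⟩
    have := Finset.single_le_sum (f := fun i => (-(ΛtoF Fq (z i)).order).toNat)
      (fun _ _ => Nat.zero_le _) (Finset.mem_univ i)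
    lia
  have hlarge := ae_finite_of_measure_le (hconv.mul_left (q ^ (m + 1))) 0
    (fun t _ => (measure_largeSet_le μ hμ (fun i => ΛtoF Fq (z i)) a K t).trans_eq (by
      congr 1
      simp only [K, q, hr, sub_sub_cancel]
      ring))
  have hsmall := ae_finite_of_measure_le (hconv.mul_left (q ^ (D₀ + 1 + m + R) * q⁻¹))
    (max D₀ D₁) (fun d hd => (measure_smallSet_le μ hm hμ hD₀ hR (K := K)
      ((le_max_left _ _).trans_lt hd) (hD₁ d ((le_max_right _ _).trans hd.le))).trans_eq (by
        congr 1
        have : -K d = -1 + r d := by simp only [K]; ring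
        rw [this, zpow_add₀ hq0, zpow_neg_one, hr]
        ring))
  exact hlarge.and hsmall
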